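/- Let F : ℝⁿ → ℝᵐ be continuously differentiable with each ∇Fᵢ Lipschitz continuous with constant L > 0, and let ψ(x,d) = max_{1≤i≤m} ⟨∇Fᵢ(x), d⟩. Fix k and suppose xₖ, dₖ ∈ ℝⁿ with dₖ ≠ 0 and ψ(xₖ,dₖ) < 0, Cₖ ∈ ℝᵐ with Fᵢ(xₖ) ≤ C_{k,i} for all i, ρ, δ ∈ (0,1), τₖ = −ψ(xₖ,dₖ)/‖dₖ‖², and let αₖ = δ^{hₖ} τₖ where hₖ is the smallest nonnegative integer j such that Fᵢ(xₖ + τₖ δʲ dₖ) ≤ C_{k,i} + ρ τₖ δʲ ψ(xₖ,dₖ) for all i. Set x_{k+1} = xₖ + αₖ dₖ and ω = min{ρ, δρ(1−ρ)/L}. Then for every i, C_{k,i} − Fᵢ(x_{k+1}) ≥ ω · ψ(xₖ,dₖ)² / ‖dₖ‖². -/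

import Mathlib

open scoped RealInnerProductSpace

noncomputable def psi {n m : ℕ} [NeZero m]
    (F : Fin m → EuclideanSpace ℝ (Fin n) → ℝ)
    (x d : EuclideanSpace ℝ (Fin n)) : ℝ :=
  Finset.univ.sup' Finset.univ_nonempty fun i => ⟪gradient (F i) x, d⟫

/-- A weak form of the descent lemma, with constant `L` in place of `L / 2`. -/
theorem le_add_inner_gradient_add_mul_sq {E : Type*} [NormedAddCommGroup E]
    [InnerProductSpace ℝ E] [CompleteSpace E] {f : E → ℝ} (hf : Differentiable ℝ f)
    {L : NNReal} (hLip : LipschitzWith L (fun y => gradient f y)) (x v : E) :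
    f (x + v) ≤ f x + ⟪gradient f x, v⟫ + L * ‖v‖ ^ 2 := by
  have hbound : ∀ z ∈ segment ℝ x (x + v), ‖fderiv ℝ f z - fderiv ℝ f x‖ ≤ L * ‖v‖ := by
    intro z hz
    have hzx : ‖z - x‖ ≤ ‖v‖ := by
      simpa using norm_sub_le_of_mem_segment hz
    have hgrad : fderiv ℝ f z - fderiv ℝ f x =
        InnerProductSpace.toDual ℝ E (gradient f z - gradient f x) := by
      simp [gradient]
    rw [hgrad, LinearIsometryEquiv.norm_map]
    exact (hLip.norm_sub_le z x).trans (by gcongr)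
  have hmean := (convex_segment x (x + v)).norm_image_sub_le_of_norm_fderiv_le'
    (fun z _ => hf z) hbound (left_mem_segment ℝ x (x + v)) (right_mem_segment ℝ x (x + v))
  have hinner : fderiv ℝ f x v = ⟪gradient f x, v⟫ := by
    simp [gradient]
  rw [add_sub_cancel_left, hinner] at hmean
  linarith [(le_abs_self _).trans hmean]

theorem inner_gradient_le_psi {n m : ℕ} [NeZero m]
    (F : Fin m → EuclideanSpace ℝ (Fin n) → ℝ) (x d : EuclideanSpace ℝ (Fin n)) (i : Fin m) :
    ⟪gradient (F i) x, d⟫ ≤ psi F x d :=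
  Finset.le_sup' (fun i => ⟪gradient (F i) x, d⟫) (Finset.mem_univ i)

/-- A step that violates the Armijo condition is bounded below. -/
theorem lt_step_of_armijo_fails {n m : ℕ} [NeZero m]
    {F : Fin m → EuclideanSpace ℝ (Fin n) → ℝ} {i : Fin m} (hF : Differentiable ℝ (F i))
    {L : ℝ} (hL : 0 < L) (hLip : LipschitzWith L.toNNReal (fun y => gradient (F i) y))
    {x d : EuclideanSpace ℝ (Fin n)} (hd : d ≠ 0) {c ρ t : ℝ} (hc : F i x ≤ c) (ht : 0 < t)
    (hfail : c + ρ * t * psi F x d < F i (x + t • d)) :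
    (1 - ρ) * -psi F x d / (L * ‖d‖ ^ 2) < t := by
  have hdescent := le_add_inner_gradient_add_mul_sq hF hLip x (t • d)
  rw [real_inner_smul_right, norm_smul, Real.norm_of_nonneg ht.le,
    Real.coe_toNNReal L hL.le] at hdescent
  have hψ := mul_le_mul_of_nonneg_left (inner_gradient_le_psi F x d i) ht.le
  have hnorm : 0 < ‖d‖ := norm_pos_iff.mpr hd
  rw [div_lt_iff₀ (by positivity)]
  refine lt_of_mul_lt_mul_left ?_ ht.le
  linarith

theorem stmt14 {n m : ℕ} [NeZero m]
    (F : Fin m → EuclideanSpace ℝ (Fin n) → ℝ)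
    (hF : ∀ i, ContDiff ℝ 1 (F i))
    (L : ℝ) (hL : 0 < L)
    (hLip : ∀ i, LipschitzWith L.toNNReal (fun y => gradient (F i) y))
    (x d : EuclideanSpace ℝ (Fin n)) (hd : d ≠ 0) (hdesc : psi F x d < 0)
    (C : Fin m → ℝ) (hCF : ∀ i, F i x ≤ C i)
    (ρ δ : ℝ) (hρ : ρ ∈ Set.Ioo (0 : ℝ) 1) (hδ : δ ∈ Set.Ioo (0 : ℝ) 1)
    (τ : ℝ) (hτ : τ = -psi F x d / ‖d‖ ^ 2)
    (h : ℕ)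
    (hArm : ∀ i, F i (x + (δ ^ h * τ) • d) ≤ C i + ρ * (δ ^ h * τ) * psi F x d)
    (hmin : ∀ j < h, ∃ i, F i (x + (δ ^ j * τ) • d) > C i + ρ * (δ ^ j * τ) * psi F x d)
    (ω : ℝ) (hω : ω = min ρ (δ * ρ * (1 - ρ) / L)) :
    ∀ i, C i - F i (x + (δ ^ h * τ) • d) ≥ ω * (psi F x d) ^ 2 / ‖d‖ ^ 2 := by
  intro i
  have hnorm : 0 < ‖d‖ := norm_pos_iff.mpr hd
  obtain ⟨hρ0, hρ1⟩ := hρ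
  obtain ⟨hδ0, hδ1⟩ := hδ
  have hψ : 0 < -psi F x d := neg_pos.mpr hdesc
  have hτ0 : 0 < τ := by rw [hτ]; positivity
  suffices hstep : ω * -psi F x d / ‖d‖ ^ 2 ≤ ρ * (δ ^ h * τ) by
    have hmul := mul_le_mul_of_nonneg_right hstep hψ.le
    have hsq : ω * -psi F x d / ‖d‖ ^ 2 * -psi F x d = ω * psi F x d ^ 2 / ‖d‖ ^ 2 := by ring
    linarith [hArm i]
  rcases h with _ | j
  · have hωρ : ω ≤ ρ := hω ▸ min_le_left _ _
    rw [pow_zero, one_mul, hτ, mul_div_assoc]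
    gcongr
  · obtain ⟨l, hl⟩ := hmin j j.lt_succ_self
    have hlower := lt_step_of_armijo_fails ((hF l).differentiable one_ne_zero) hL (hLip l) hd
      (hCF l) (by positivity) hl
    calc ω * -psi F x d / ‖d‖ ^ 2
        ≤ δ * ρ * (1 - ρ) / L * -psi F x d / ‖d‖ ^ 2 := by
          gcongr
          exact hω ▸ min_le_right _ _
      _ = ρ * δ * ((1 - ρ) * -psi F x d / (L * ‖d‖ ^ 2)) := by field_simp
      _ ≤ ρ * δ * (δ ^ j * τ) := by gcongr
      _ = ρ * (δ ^ (j + 1) * τ) := by ring
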